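/- For the Heisenberg Lie algebra h(m) of dimension 2m+1 over ℂ with m ≥ 2, the Schur multiplier M(h(m)) = H²(h(m),ℂ) has dimension 2m² − m − 1. -/

import Mathlib

set_option maxSynthPendingDepth 3
set_option synthInstance.maxHeartbeats 1000000

open Module

variable (k L : Type*) [CommRing k] [LieRing L] [LieAlgebra k L]

/-- Chevalley–Eilenberg 2-cocycles of `L` with trivial coefficients in `k`: alternating
bilinear forms `f` with `f(⁅x,y⁆,z) + f(⁅y,z⁆,x) + f(⁅z,x⁆,y) = 0`. -/
def twoCocycles : Submodule k (L →ₗ[k] L →ₗ[k] k) where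
  carrier := {f | (∀ x, f x x = 0) ∧
    ∀ x y z, f ⁅x, y⁆ z + f ⁅y, z⁆ x + f ⁅z, x⁆ y = 0}
  add_mem' := by
    rintro f g ⟨hf1, hf2⟩ ⟨hg1, hg2⟩
    refine ⟨fun x => ?_, fun x y z => ?_⟩
    · simp [hf1, hg1]
    · simpa using by linear_combination hf2 x y z + hg2 x y z
  zero_mem' := ⟨fun x => rfl, fun x y z => by simp⟩
  smul_mem' := by
    rintro c f ⟨hf1, hf2⟩
    refine ⟨fun x => ?_, fun x y z => ?_⟩
    · simp [hf1]
    · simpa using by linear_combination c * hf2 x y z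

/-- Chevalley–Eilenberg 2-coboundaries of `L` with trivial coefficients in `k`: bilinear
forms of the shape `(x, y) ↦ g ⁅x, y⁆` for a linear functional `g`. -/
def twoCoboundaries : Submodule k (L →ₗ[k] L →ₗ[k] k) where
  carrier := {f | ∃ g : L →ₗ[k] k, ∀ x y, f x y = g ⁅x, y⁆}
  add_mem' := by
    rintro f₁ f₂ ⟨g₁, h₁⟩ ⟨g₂, h₂⟩
    exact ⟨g₁ + g₂, fun x y => by simp [h₁, h₂]⟩
  zero_mem' := ⟨0, fun x y => by simp⟩
  smul_mem' := by
    rintro c f ⟨g, h⟩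
    exact ⟨c • g, fun x y => by simp [h]⟩

/-- The Schur multiplier `M(L) = H²(L, k)`: the second Chevalley–Eilenberg cohomology of `L`
with trivial coefficients, i.e. 2-cocycles modulo 2-coboundaries. -/
abbrev schurMultiplier :=
  twoCocycles k L ⧸ (twoCoboundaries k L).comap (twoCocycles k L).subtype

instance : AddCommGroup (schurMultiplier k L) := Submodule.Quotient.addCommGroup _

instance : Module k (schurMultiplier k L) := Submodule.Quotient.module _

/-- A linear functional `φ` with `ω ∧ φ = 0` vanishes, when `ω` is alternating with radical of
small dimension. -/
lemma heis_wedge {M : Type*} [AddCommGroup M] [Module ℂ M] [FiniteDimensional ℂ M]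
    (w : M →ₗ[ℂ] M →ₗ[ℂ] ℂ) (hw : ∀ x y, w x y = - w y x)
    (R : Submodule ℂ M) (hR : ∀ x, (∀ y, w x y = 0) → x ∈ R)
    (hR1 : finrank ℂ R + 2 < finrank ℂ M)
    (φ : M →ₗ[ℂ] ℂ)
    (h : ∀ x y t, w x y * φ t + w y t * φ x + w t x * φ y = 0) (t : M) : φ t = 0 := by
  by_contra ht
  -- the orthogonal complement of `t` is isotropic
  have hiso : ∀ x y, w t x = 0 → w t y = 0 → w x y = 0 := by
    intro x y hx hy
    have := h x y t
    rw [hw y t, hx, hy] at this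
    simpa [ht] using this
  have key : ∃ s, ∀ x, w t x = 0 → w s x = 0 → x ∈ R := by
    by_cases h0 : ∀ s, w t s = 0
    · refine ⟨0, fun x hx _ => hR x fun y => hiso x y hx (h0 y)⟩
    · push Not at h0
      obtain ⟨s, hs⟩ := h0
      refine ⟨s, fun x hx hsx => hR x fun y => ?_⟩
      have h1 : w t (y - (w t y / w t s) • s) = 0 := by
        simp [hs]
      have h2 := hiso x _ hx h1
      rw [map_sub, map_smul, hw x s, hsx] at h2
      simpa using h2
  obtain ⟨s, hs⟩ := key
  let T : M →ₗ[ℂ] ℂ × ℂ := (w t).prod (w s)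
  have hker : LinearMap.ker T ≤ R := by
    intro x hx
    have : w t x = 0 ∧ w s x = 0 := by simpa [T] using hx
    exact hs x this.1 this.2
  have h1 := Submodule.finrank_mono hker
  have h2 := LinearMap.finrank_range_add_finrank_ker T
  have h3 := Submodule.finrank_le (LinearMap.range T)
  have h4 : finrank ℂ (ℂ × ℂ) = 2 := by simp
  omega

lemma heis_card (n : ℕ) :
    2 * Fintype.card {p : Fin n × Fin n // p.2 < p.1} + n = n * n := by
  have e := Fintype.card_congr
    (Equiv.subtypeProdEquivSigmaSubtype (fun (a b : Fin n) => b < a))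
  rw [e, Fintype.card_sigma]
  have : ∀ a : Fin n, Fintype.card {b : Fin n // b < a} = a := by
    intro a
    rw [Fintype.card_subtype]
    have h : (Finset.univ.filter fun x : Fin n => x < a) = Finset.Iio a := by ext; simp
    rw [h, Fin.card_Iio]
  simp_rw [this]
  rw [Fin.sum_univ_eq_sum_range (fun i => i) n]
  have := Finset.sum_range_id_mul_two n
  cases n with
  | zero => simp
  | succ n => simp only [Nat.add_sub_cancel] at this; nlinarith

/-- A basis with prescribed zeroth vector. -/
lemma heis_basis {M : Type*} [AddCommGroup M] [Module ℂ M] [FiniteDimensional ℂ M]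
    (n : ℕ) (hdim : finrank ℂ M = n + 1) (z : M) (hz : z ≠ 0) :
    ∃ b : Basis (Fin (n + 1)) ℂ M, b 0 = z := by
  have hli : LinearIndepOn ℂ id ({z} : Set M) := LinearIndepOn.singleton hz
  let b := Basis.extend hli
  have hmem : z ∈ hli.extend (Set.subset_univ _) := hli.subset_extend _ rfl
  have : Fintype (hli.extend (Set.subset_univ {z})) := FiniteDimensional.fintypeBasisIndex b
  have hc : Fintype.card (hli.extend (Set.subset_univ {z})) = n + 1 := by
    rw [← hdim, finrank_eq_card_basis b]
  let e := Fintype.equivFinOfCardEq hc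
  let e' := e.trans (Equiv.swap (e ⟨z, hmem⟩) 0)
  refine ⟨b.reindex e', ?_⟩
  have : e'.symm 0 = ⟨z, hmem⟩ := by
    rw [Equiv.symm_apply_eq]; simp [e']
  rw [Basis.reindex_apply, this]
  simp [b]

/-- alternating forms with `b 0` in the radical -/
lemma heis_alt {M : Type*} [AddCommGroup M] [Module ℂ M]
    (n : ℕ) (b : Basis (Fin (n + 1)) ℂ M) (C : Submodule ℂ (M →ₗ[ℂ] M →ₗ[ℂ] ℂ))
    (hC : ∀ f, f ∈ C ↔ (∀ x, f x x = 0) ∧ ∀ y, f (b 0) y = 0) :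
    finrank ℂ C = Fintype.card {p : Fin n × Fin n // p.2 < p.1} := by
  let T : C →ₗ[ℂ] ({p : Fin n × Fin n // p.2 < p.1} → ℂ) :=
    { toFun := fun f p => f.1 (b p.1.1.succ) (b p.1.2.succ)
      map_add' := fun f g => rfl
      map_smul' := fun f g => rfl }
  have skew : ∀ f : M →ₗ[ℂ] M →ₗ[ℂ] ℂ, (∀ x, f x x = 0) → ∀ x y, f x y = - f y x := by
    intro f hf x y
    have := hf (x + y)
    simp only [map_add, LinearMap.add_apply, hf, zero_add, add_zero] at this
    linear_combination this
  have hinj : Function.Injective T := by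
    rw [injective_iff_map_eq_zero]
    rintro ⟨f, hf⟩ h0
    obtain ⟨h1, h2⟩ := (hC f).1 hf
    have h3 := skew f h1
    have h4 : ∀ i j : Fin n, j < i → f (b i.succ) (b j.succ) = 0 :=
      fun i j hij => congrFun h0 ⟨(i, j), hij⟩
    ext1
    refine b.ext fun i => b.ext fun j => ?_
    change f (b i) (b j) = 0
    induction i using Fin.cases with
    | zero => exact h2 _
    | succ i =>
      induction j using Fin.cases with
      | zero => rw [h3, h2, neg_zero]
      | succ j =>
        rcases lt_trichotomy i j with h | h | h
        · rw [h3, h4 _ _ h, neg_zero]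
        · rw [h, h1]
        · exact h4 _ _ h
  have hsurj : Function.Surjective T := by
    intro c
    let A : Fin n → Fin n → ℂ := fun i j =>
      if h : j < i then c ⟨(i, j), h⟩ else if h : i < j then - c ⟨(j, i), h⟩ else 0
    have hA : ∀ i j, A i j = - A j i := by
      intro i j
      rcases lt_trichotomy i j with h | h | h
      · simp [A, h, h.not_gt]
      · simp [A, h]
      · simp [A, h, h.not_gt]
    let A' : Fin (n + 1) → Fin (n + 1) → ℂ := fun i j =>
      Fin.cases 0 (fun i => Fin.cases 0 (fun j => A i j) j) i
    have hA' : ∀ i j, A' i j = - A' j i := by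
      intro i j
      induction i using Fin.cases <;> induction j using Fin.cases <;> simp [A']
      exact hA _ _
    let f : M →ₗ[ℂ] M →ₗ[ℂ] ℂ := b.constr ℂ (fun i => b.constr ℂ (fun j => A' i j))
    have hf : ∀ i j, f (b i) (b j) = A' i j := by
      intro i j
      simp [f, Basis.constr_basis]
    have hfl : f = - f.flip := by
      refine b.ext fun i => b.ext fun j => ?_
      simp only [LinearMap.neg_apply, LinearMap.flip_apply, hf]
      exact hA' i j
    have hmem : f ∈ C := by
      rw [hC]
      constructor
      · intro x
        have : f x x = - f x x := by
          conv_lhs => rw [hfl]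
          rfl
        linear_combination this / 2
      · intro y
        have : f (b 0) = 0 := by
          refine b.ext fun j => ?_
          rw [hf]; simp [A']
        rw [this]; rfl
    refine ⟨⟨f, hmem⟩, ?_⟩
    funext p
    obtain ⟨⟨i, j⟩, hp⟩ := p
    change f (b i.succ) (b j.succ) = _
    rw [hf]
    simp only at hp
    simp [A', A, hp]
  rw [(LinearEquiv.ofBijective T ⟨hinj, hsurj⟩).finrank_eq, finrank_fintype_fun_eq_card]

/-- the Schur multiplier of the Heisenberg algebra `h(m)` of dimension
`2m+1` over `ℂ`, for `m ≥ 2`, has dimension `2m² - m - 1`. -/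
theorem stmt_10 (M : Type*) [LieRing M] [LieAlgebra ℂ M] [FiniteDimensional ℂ M]
    (m : ℕ) (hm : 2 ≤ m)
    (hcz : LieAlgebra.derivedSeries ℂ M 1 = LieAlgebra.center ℂ M)
    (hone : finrank ℂ (LieAlgebra.derivedSeries ℂ M 1) = 1)
    (hdim : finrank ℂ M = 2 * m + 1) :
    finrank ℂ (schurMultiplier ℂ M) = 2 * m ^ 2 - m - 1 := by
  have hbr : ∀ x y : M, ⁅x, y⁆ ∈ LieAlgebra.derivedSeries ℂ M 1 := by
    intro x y
    rw [LieAlgebra.derivedSeries_def, LieAlgebra.derivedSeriesOfIdeal_succ,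
      LieAlgebra.derivedSeriesOfIdeal_zero]
    exact LieSubmodule.lie_mem_lie (LieSubmodule.mem_top x) (LieSubmodule.mem_top y)
  obtain ⟨⟨z, hzD⟩, hz0, hzs⟩ := finrank_eq_one_iff'.1 hone
  have hz : z ≠ 0 := fun h => hz0 (Subtype.ext h)
  have hspan : ∀ x ∈ LieAlgebra.derivedSeries ℂ M 1, ∃ c : ℂ, c • z = x := by
    intro x hx
    obtain ⟨c, hc⟩ := hzs ⟨x, hx⟩
    exact ⟨c, congrArg Subtype.val hc⟩
  obtain ⟨b, hb⟩ := heis_basis (2 * m) hdim z hz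
  let w : M →ₗ[ℂ] M →ₗ[ℂ] ℂ :=
    LinearMap.mk₂ ℂ (fun x y => b.coord 0 ⁅x, y⁆) (by simp) (by simp) (by simp) (by simp)
  have hw : ∀ x y, w x y = b.coord 0 ⁅x, y⁆ := fun x y => rfl
  have hwz : ∀ x y : M, ⁅x, y⁆ = w x y • z := by
    intro x y
    obtain ⟨c, hc⟩ := hspan _ (hbr x y)
    rw [hw, ← hc, ← hb]
    simp
  have hzc : ∀ y : M, ⁅z, y⁆ = 0 := by
    intro y
    rw [hcz] at hzD
    have := (LieModule.mem_maxTrivSubmodule ℂ M M z).1 hzD y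
    rw [← lie_skew, this, neg_zero]
  have hskew : ∀ x y, w x y = - w y x := by
    intro x y
    rw [hw, hw, ← lie_skew, map_neg]
  have hrad : ∀ x, (∀ y, w x y = 0) → x ∈ (LieAlgebra.derivedSeries ℂ M 1).toSubmodule := by
    intro x hx
    rw [hcz]
    refine (LieModule.mem_maxTrivSubmodule ℂ M M x).2 fun y => ?_
    rw [hwz, hskew, hx, neg_zero, zero_smul]
  have hone' : finrank ℂ (LieAlgebra.derivedSeries ℂ M 1).toSubmodule = 1 := hone
  have hC : ∀ f, f ∈ twoCocycles ℂ M ↔ (∀ x, f x x = 0) ∧ ∀ y, f (b 0) y = 0 := by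
    intro f
    rw [hb]
    constructor
    · rintro ⟨h1, h2⟩
      refine ⟨h1, fun y => ?_⟩
      refine heis_wedge w hskew _ hrad (by omega) (f z) (fun x y t => ?_) y
      have := h2 x y t
      rw [hwz x y, hwz y t, hwz t x] at this
      simpa using this
    · rintro ⟨h1, h2⟩
      refine ⟨h1, fun x y t => ?_⟩
      rw [hwz x y, hwz y t, hwz t x]
      simp [h2]
  have hdimC := heis_alt (2 * m) b _ hC
  have hB : twoCoboundaries ℂ M = Submodule.span ℂ {w} := by
    ext f
    rw [Submodule.mem_span_singleton]
    constructor
    · rintro ⟨g, hg⟩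
      refine ⟨g z, ?_⟩
      ext x y
      rw [hg, hwz x y]
      simp [mul_comm]
    · rintro ⟨c, rfl⟩
      exact ⟨c • b.coord 0, fun x y => rfl⟩
  have hw0 : w ≠ 0 := by
    intro h
    have : (⊤ : Submodule ℂ M) ≤ (LieAlgebra.derivedSeries ℂ M 1).toSubmodule :=
      fun x _ => hrad x fun y => by rw [h]; rfl
    have := Submodule.finrank_mono this
    rw [finrank_top] at this
    omega
  have hle : twoCoboundaries ℂ M ≤ twoCocycles ℂ M := by
    rw [hB, Submodule.span_singleton_le_iff_mem, hC]
    refine ⟨fun x => by simp [hw], fun y => ?_⟩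
    rw [hw, hb, hzc, map_zero]
  have hdimB : finrank ℂ ((twoCoboundaries ℂ M).comap (twoCocycles ℂ M).subtype) = 1 := by
    rw [(Submodule.comapSubtypeEquivOfLe hle).finrank_eq, hB, finrank_span_singleton hw0]
  have hq := Submodule.finrank_quotient_add_finrank
    ((twoCoboundaries ℂ M).comap (twoCocycles ℂ M).subtype)
  rw [hdimB, hdimC] at hq
  have hcard := heis_card (2 * m)
  have hm2 : 2 * m * (2 * m) = 4 * m ^ 2 := by ring
  change finrank ℂ (twoCocycles ℂ M ⧸ (twoCoboundaries ℂ M).comap (twoCocycles ℂ M).subtype) = _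
  omega
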